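/- There exists a constant K > 0 such that for every ℓ ≥ 2, the permutation p of C_ℓ (for the decorated SMART state set and alphabet) belongs to G_ℓ with word norm at most K, where p fixes head-free configurations and maps each configuration with head (q, w₀) at position i and tape letter w₁ at position i+1 mod ℓ to the configuration with head (q, w₁) at position i and tape letter w₀ at position i+1 mod ℓ (i.e., p swaps the two adjacent tape letters at and to the right of the head, leaving the head position and state unchanged). In particular the bound K is independent of ℓ. -/

import Mathlib

/-- The word norm of `g` with respect to the generating set `F`:
the least `n` such that `g` is a product of `n` elements of `F ∪ F⁻¹`. -/
noncomputable def wordNorm {G : Type*} [Group G] (F : Set G) (g : G) : ℕ :=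
  sInf {n : ℕ | ∃ w : List G, w.length = n ∧ (∀ x ∈ w, x ∈ F ∨ x⁻¹ ∈ F) ∧ w.prod = g}
/-! ### Turing machine symbols and local step functions -/

/-- Tape/head symbols: a plain tape letter, or a head `(q, a)` on top of letter `a`. -/
abbrev TSym (Q Γ : Type) : Type := Γ ⊕ (Q × Γ)

/-- The tape letter carried by a cell (under the head if the cell carries the head). -/
def tapeLetter {Q Γ : Type} : TSym Q Γ → Γ
  | Sum.inl a => a
  | Sum.inr (_, a) => a

/-- A complete deterministic machine is given by a head-step function: at `(q, a)` it either
rewrites the head in place (`.inl (q', b)`, a matching transition), or moves in direction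
`δ ∈ {+1, -1}` into state `q'` (`.inr (δ, q')`, a move transition). -/
abbrev HeadStep (Q Γ : Type) : Type := Q → Γ → ((Q × Γ) ⊕ (ℤ × Q))

/-- If the symbol `s` carries a head about to move in direction `d`, the state in which the
head arrives; `none` otherwise. -/
def arrivesAs {Q Γ : Type} (δ : HeadStep Q Γ) (s : TSym Q Γ) (d : ℤ) : Option Q :=
  match s with
  | Sum.inl _ => none
  | Sum.inr (q, a) =>
    match δ q a with
    | Sum.inl _ => none
    | Sum.inr (d', q') => if d' = d then some q' else none

/-- The local rule of the moving-head dynamics: the new symbol of a cell, given the symbols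
`l, c, r` of its left neighbour, itself, and its right neighbour. -/
def localStep {Q Γ : Type} (δ : HeadStep Q Γ) (l c r : TSym Q Γ) : TSym Q Γ :=
  match c with
  | Sum.inr (q, a) =>
    (match δ q a with
     | Sum.inl qb => Sum.inr qb
     | Sum.inr _ => Sum.inl a)
  | Sum.inl a =>
    (match arrivesAs δ l 1 with
     | some q' => Sum.inr (q', a)
     | none =>
       match arrivesAs δ r (-1) with
       | some q' => Sum.inr (q', a)
       | none => Sum.inl a)

/-- The moving-head action of a complete deterministic machine on bi-infinite tapes. -/
def stepZ {Q Γ : Type} (δ : HeadStep Q Γ) (x : ℤ → TSym Q Γ) : ℤ → TSym Q Γ :=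
  fun i => localStep δ (x (i - 1)) (x i) (x (i + 1))

/-- The action of a complete deterministic machine on cyclic tapes of length `ℓ`. -/
def stepC {Q Γ : Type} (δ : HeadStep Q Γ) (ℓ : ℕ) (w : ZMod ℓ → TSym Q Γ) :
    ZMod ℓ → TSym Q Γ :=
  fun i => localStep δ (w (i - 1)) (w i) (w (i + 1))

/-- A configuration has at most one head. -/
def AtMostOneHeadZ {Q Γ : Type} (x : ℤ → TSym Q Γ) : Prop :=
  ∀ i j : ℤ, (x i).isRight = true → (x j).isRight = true → i = j

/-- A cyclic configuration has at most one head. -/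
def AtMostOneHeadC {Q Γ : Type} {ℓ : ℕ} (w : ZMod ℓ → TSym Q Γ) : Prop :=
  ∀ i j : ZMod ℓ, (w i).isRight = true → (w j).isRight = true → i = j

/-! ### The SMART machine -/

/-- The four arrows `▶, ◀, ▷, ◁` (filled right/left, hollow right/left). -/
inductive Arrow : Type
  | rf  -- ▶ (filled right)
  | lf  -- ◀ (filled left)
  | rh  -- ▷ (hollow right)
  | lh  -- ◁ (hollow left)
deriving DecidableEq

/-- The SMART state set `Q̊`: an arrow with a subscript in `{1,2}`; the subscript `b`
is represented by the `Fin 2` value `b - 1`. -/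
abbrev SQ : Type := Arrow × Fin 2

/-- The SMART tape alphabet `{0,1,2}`. -/
abbrev Letter : Type := Fin 3

/-- The head-step function of the SMART machine.  States `q₂` (second component `1`) are
move states; states `q₁` (second component `0`) are matching states. -/
def smartStep : HeadStep SQ Letter := fun q a =>
  if q.2 = 1 then
    match q.1 with
    | .rf => Sum.inr (1, (.rf, 0))   -- (▶₂, +1, ▶₁)
    | .lf => Sum.inr (-1, (.lf, 0))  -- (◀₂, −1, ◀₁)
    | .rh => Sum.inr (1, (.rh, 0))   -- (▷₂, +1, ▷₁)
    | .lh => Sum.inr (-1, (.lh, 0))  -- (◁₂, −1, ◁₁)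
  else
    match q.1 with
    | .rf => Sum.inl (if a = 0 then ((.lf, 1), 1) else if a = 1 then ((.lh, 1), 1) else ((.lh, 1), 2))
    | .lf => Sum.inl (if a = 0 then ((.rf, 1), 1) else if a = 1 then ((.rh, 1), 1) else ((.rh, 1), 2))
    | .rh => Sum.inl (if a = 0 then ((.rf, 1), 2) else if a = 1 then ((.rf, 1), 0) else ((.lh, 1), 0))
    | .lh => Sum.inl (if a = 0 then ((.lf, 1), 2) else if a = 1 then ((.lf, 1), 0) else ((.rh, 1), 0))

/-! ### The decorated SMART machine -/

/-- The state set of the decorated SMART machine: a SMART state together with a *duck*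
`d ∈ {d₀, d₁}` (as `Fin 2`, `0 ↦ d₀`) and a *ghost* `x ∈ {0,…,5}` (as `Fin 6`). -/
abbrev DQ : Type := SQ × Fin 2 × Fin 6

/-- The head-step function of the decorated SMART machine: it acts as SMART on the
`Q̊`-component and carries the duck and ghost unchanged. -/
def decStep : HeadStep DQ Letter := fun q a =>
  match smartStep q.1 a with
  | Sum.inl (q', b) => Sum.inl ((q', q.2), b)
  | Sum.inr (d, q') => Sum.inr (d, (q', q.2))

/-! ### The group `G_ℓ` of Turing machine instructions on cyclic tapes -/

/-- Cyclic configurations of length `ℓ` with at most one head. -/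
abbrev CConf (Q Γ : Type) (ℓ : ℕ) : Type :=
  {w : ZMod ℓ → TSym Q Γ // AtMostOneHeadC w}

/-- The pointwise action on symbols of a permutation `g` of head symbols. -/
def gateApply {Q Γ : Type} (g : Equiv.Perm (Q × Γ)) : TSym Q Γ → TSym Q Γ
  | Sum.inl a => Sum.inl a
  | Sum.inr h => Sum.inr (g h)

/-- `π` is the unary gate `π_g`: it applies `g` to the head symbol (if a head is present)
and fixes all other cells. -/
def IsUnaryGate {Q Γ : Type} {ℓ : ℕ} (g : Equiv.Perm (Q × Γ))
    (π : Equiv.Perm (CConf Q Γ ℓ)) : Prop :=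
  ∀ w : CConf Q Γ ℓ, ∀ i : ZMod ℓ, (π w).1 i = gateApply g (w.1 i)

/-- `π` is the state-dependent right move `ρ_q`: it moves a head in state `q` one position
to the right (mod `ℓ`), leaving its tape letter behind and picking up the next cell's
letter, and fixes configurations whose head is not in state `q`. -/
def IsMoveGate {Q Γ : Type} [DecidableEq Q] {ℓ : ℕ} (q : Q)
    (π : Equiv.Perm (CConf Q Γ ℓ)) : Prop :=
  ∀ w : CConf Q Γ ℓ,
    ((∀ i a, w.1 i ≠ Sum.inr (q, a)) → π w = w) ∧
    (∀ i a, w.1 i = Sum.inr (q, a) →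
      ∀ j : ZMod ℓ, (π w).1 j =
        if j = i + 1 then Sum.inr (q, tapeLetter (w.1 (i + 1)))
        else if j = i then Sum.inl a
        else w.1 j)

/-- The generating set of the group `G_ℓ` of Turing machine instructions: all unary gates
`π_g` and all state-dependent moves `ρ_q`. -/
def TMGens (Q Γ : Type) [DecidableEq Q] (ℓ : ℕ) : Set (Equiv.Perm (CConf Q Γ ℓ)) :=
  {π | (∃ g, IsUnaryGate g π) ∨ (∃ q, IsMoveGate q π)}

/-! ### Cyclic configurations as tapes with an optional marked head -/

section HeadedTapes

variable {Q Γ : Type} {ℓ : ℕ}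

/-- A plain cyclic tape, or a head position, a head state and the cyclic tape below the head. -/
abbrev HeadedTape (Q Γ : Type) (ℓ : ℕ) : Type :=
  (ZMod ℓ → Γ) ⊕ (ZMod ℓ × Q × (ZMod ℓ → Γ))

/-- The cyclic word of symbols described by a headed tape. -/
def HeadedTape.toWord : HeadedTape Q Γ ℓ → ZMod ℓ → TSym Q Γ
  | Sum.inl t => fun j => Sum.inl (t j)
  | Sum.inr (i, q, t) => fun j => if j = i then Sum.inr (q, t j) else Sum.inl (t j)

theorem HeadedTape.atMostOneHeadC_toWord (x : HeadedTape Q Γ ℓ) : AtMostOneHeadC x.toWord := by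
  rcases x with t | ⟨k, q, t⟩
  · intro i j hi
    simp [toWord] at hi
  · intro i j hi hj
    simp only [toWord] at hi hj
    split_ifs at hi hj <;> simp_all

theorem HeadedTape.tapeLetter_toWord (i : ZMod ℓ) (q : Q) (t : ZMod ℓ → Γ) (j : ZMod ℓ) :
    tapeLetter (toWord (Sum.inr (i, q, t)) j) = t j := by
  simp only [toWord]
  split_ifs <;> rfl

theorem HeadedTape.toWord_injective :
    Function.Injective (toWord : HeadedTape Q Γ ℓ → ZMod ℓ → TSym Q Γ) := by
  rintro (t | ⟨i, q, t⟩) (t' | ⟨i', q', t'⟩) h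
  · congr 1
    funext j
    simpa [toWord] using congrFun h j
  · simpa [toWord] using congrFun h i'
  · simpa [toWord] using congrFun h i
  · have hi : i = i' := by
      by_contra hne
      simpa [toWord, hne] using congrFun h i
    subst hi
    have hq : q = q' ∧ t i = t' i := by simpa [toWord] using congrFun h i
    have ht : t = t' := by
      funext j
      rw [← tapeLetter_toWord i q t j, h, tapeLetter_toWord]
    rw [hq.1, ht]

theorem HeadedTape.exists_toWord_eq {w : ZMod ℓ → TSym Q Γ} (hw : AtMostOneHeadC w) :
    ∃ x : HeadedTape Q Γ ℓ, x.toWord = w := by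
  by_cases h : ∃ i, (w i).isRight = true
  · obtain ⟨i, hi⟩ := h
    obtain ⟨⟨q, a⟩, hqa⟩ := Sum.isRight_iff.mp hi
    refine ⟨Sum.inr (i, q, fun j => tapeLetter (w j)), funext fun j => ?_⟩
    by_cases hj : j = i
    · subst hj
      simp [toWord, hqa, tapeLetter]
    · have hl : (w j).isRight = false := by
        by_contra hr
        exact hj (hw j i (by simpa using hr) hi)
      obtain ⟨b, hb⟩ := Sum.isLeft_iff.mp (Sum.isRight_eq_false.mp hl)
      simp [toWord, hj, hb, tapeLetter]
  · push Not at h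
    refine ⟨Sum.inl fun j => tapeLetter (w j), funext fun j => ?_⟩
    obtain ⟨b, hb⟩ := Sum.isLeft_iff.mp (Sum.isRight_eq_false.mp (by simpa using h j))
    simp [toWord, hb, tapeLetter]

/-- Headed tapes are the same as cyclic configurations with at most one head. -/
noncomputable def HeadedTape.equivCConf (Q Γ : Type) (ℓ : ℕ) :
    HeadedTape Q Γ ℓ ≃ CConf Q Γ ℓ :=
  Equiv.ofBijective (fun x => ⟨x.toWord, x.atMostOneHeadC_toWord⟩)
    ⟨fun _ _ h => toWord_injective (congrArg Subtype.val h),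
      fun w => (exists_toWord_eq w.2).imp fun _ h => Subtype.ext h⟩

theorem HeadedTape.equivCConf_val (x : HeadedTape Q Γ ℓ) :
    (equivCConf Q Γ ℓ x).1 = x.toWord := rfl

/-- Permutations of headed tapes, regarded as permutations of cyclic configurations. -/
noncomputable def HeadedTape.permHom (Q Γ : Type) (ℓ : ℕ) :
    Equiv.Perm (HeadedTape Q Γ ℓ) →* Equiv.Perm (CConf Q Γ ℓ) :=
  (equivCConf Q Γ ℓ).permCongrHom.toMonoidHom

theorem HeadedTape.permHom_apply (f : Equiv.Perm (HeadedTape Q Γ ℓ)) (x : HeadedTape Q Γ ℓ) :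
    permHom Q Γ ℓ f (equivCConf Q Γ ℓ x) = equivCConf Q Γ ℓ (f x) := by
  simp [permHom, Equiv.permCongrHom]

/-! ### Gates, moves and letter swaps on headed tapes -/

/-- The action of `g : Q × Γ → Q × Γ` on the head symbol of a headed tape. -/
def HeadedTape.applyGate (g : Q × Γ → Q × Γ) : HeadedTape Q Γ ℓ → HeadedTape Q Γ ℓ
  | Sum.inl t => Sum.inl t
  | Sum.inr (i, q, t) =>
    Sum.inr (i, (g (q, t i)).1, Function.update t i (g (q, t i)).2)

/-- The unary gate of `g` on headed tapes. -/
def HeadedTape.gate (g : Equiv.Perm (Q × Γ)) : Equiv.Perm (HeadedTape Q Γ ℓ) where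
  toFun := applyGate g
  invFun := applyGate g.symm
  left_inv x := by rcases x with t | ⟨i, q, t⟩ <;> simp [applyGate]
  right_inv x := by rcases x with t | ⟨i, q, t⟩ <;> simp [applyGate]

/-- The permutation of headed tapes moving a head in state `q` by `k q` positions. -/
def HeadedTape.shift (k : Q → ZMod ℓ) : Equiv.Perm (HeadedTape Q Γ ℓ) where
  toFun := Sum.map id fun h => (h.1 + k h.2.1, h.2)
  invFun := Sum.map id fun h => (h.1 - k h.2.1, h.2)
  left_inv x := by rcases x with t | ⟨i, q, t⟩ <;> simp
  right_inv x := by rcases x with t | ⟨i, q, t⟩ <;> simp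

/-- The permutation of headed tapes swapping the letter below the head with the next one. -/
def HeadedTape.swapLetters : Equiv.Perm (HeadedTape Q Γ ℓ) where
  toFun := Sum.map id fun h => (h.1, h.2.1, h.2.2 ∘ Equiv.swap h.1 (h.1 + 1))
  invFun := Sum.map id fun h => (h.1, h.2.1, h.2.2 ∘ Equiv.swap h.1 (h.1 + 1))
  left_inv x := by
    rcases x with t | ⟨i, q, t⟩ <;> simp [Function.comp_assoc, ← Equiv.coe_trans]
  right_inv x := by
    rcases x with t | ⟨i, q, t⟩ <;> simp [Function.comp_assoc, ← Equiv.coe_trans]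

theorem HeadedTape.isUnaryGate_gate (g : Equiv.Perm (Q × Γ)) :
    IsUnaryGate g (permHom Q Γ ℓ (gate g)) := by
  intro w j
  obtain ⟨x, rfl⟩ := (equivCConf Q Γ ℓ).surjective w
  rw [permHom_apply, equivCConf_val, equivCConf_val]
  rcases x with t | ⟨i, q, t⟩
  · rfl
  · by_cases hj : j = i
    · subst hj
      simp [gate, applyGate, toWord, gateApply]
    · simp [gate, applyGate, toWord, gateApply, hj]

theorem HeadedTape.isMoveGate_shift_single [DecidableEq Q] (q : Q) :
    IsMoveGate q (permHom Q Γ ℓ (shift (Pi.single q 1))) := by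
  intro w
  obtain ⟨x, rfl⟩ := (equivCConf Q Γ ℓ).surjective w
  rw [permHom_apply]
  simp only [equivCConf_val]
  rcases x with t | ⟨k, p, t⟩
  · exact ⟨fun _ => rfl, fun i a h => by simp [toWord] at h⟩
  refine ⟨fun h => ?_, fun i a h j => ?_⟩
  · have hp : p ≠ q := by
      rintro rfl
      exact h k (t k) (by simp [toWord])
    simp [shift, hp]
  · have hi : i = k := by
      by_contra hne
      simp [toWord, hne] at h
    subst hi
    obtain ⟨rfl, rfl⟩ : p = q ∧ t i = a := by simpa [toWord] using h
    rw [tapeLetter_toWord]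
    by_cases hj : j = i + 1
    · subst hj
      simp [shift, toWord]
    · by_cases hji : j = i
      · subst hji
        simp [shift, toWord, hj]
      · simp [shift, toWord, hj, hji]

theorem HeadedTape.prod_map_shift (L : List (Q → ZMod ℓ)) :
    (L.map shift).prod = (shift L.sum : Equiv.Perm (HeadedTape Q Γ ℓ)) := by
  induction L with
  | nil =>
    ext x : 1
    rcases x with t | ⟨i, q, t⟩ <;> simp [shift]
  | cons k L ih =>
    ext x : 1
    rw [List.map_cons, List.prod_cons, ih]
    rcases x with t | ⟨i, q, t⟩ <;> simp [shift, add_comm, add_left_comm]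

theorem HeadedTape.prod_map_shift_single [Fintype Q] [DecidableEq Q] :
    (Finset.univ.toList.map fun q : Q => shift (Pi.single q 1)).prod =
      (shift 1 : Equiv.Perm (HeadedTape Q Γ ℓ)) := by
  have h := prod_map_shift (Γ := Γ)
    (Finset.univ.toList.map fun q : Q => (Pi.single q 1 : Q → ZMod ℓ))
  rw [List.map_map] at h
  refine h.trans (congrArg _ ?_)
  rw [Finset.sum_map_toList]
  exact Finset.univ_sum_single (1 : Q → ZMod ℓ)

/-- If states carry a letter register, the permutation exchanging it with the letter read. -/
def exchangeRegister {R : Type} (e : Q ≃ Γ × R) : Equiv.Perm (Q × Γ) where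
  toFun h := (e.symm (h.2, (e h.1).2), (e h.1).1)
  invFun h := (e.symm (h.2, (e h.1).2), (e h.1).1)
  left_inv h := by simp
  right_inv h := by simp

/-- Exchanging the register with the letter under the head, then with the next letter, and then
with the letter under the head again swaps these two letters. -/
theorem HeadedTape.swapLetters_eq {R : Type} (e : Q ≃ Γ × R) (hℓ : 2 ≤ ℓ) :
    (swapLetters : Equiv.Perm (HeadedTape Q Γ ℓ)) =
      gate (exchangeRegister e) * (shift 1)⁻¹ * gate (exchangeRegister e) * shift 1 *
        gate (exchangeRegister e) := by
  have : Fact (1 < ℓ) := ⟨hℓ⟩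
  ext x : 1
  rcases x with t | ⟨i, q, t⟩
  · rfl
  · have hne : i + 1 ≠ i := by simp
    simp only [Equiv.Perm.mul_apply, gate, shift, swapLetters, applyGate, exchangeRegister,
      Equiv.coe_fn_mk, Sum.map_inr, Equiv.Perm.inv_def, Equiv.coe_fn_symm_mk]
    simp only [Pi.one_apply, add_sub_cancel_right, Equiv.apply_symm_apply, Function.update_self,
      Function.update_of_ne hne, Function.update_of_ne hne.symm, Equiv.symm_apply_apply,
      Prod.mk.eta]
    refine congrArg Sum.inr (Prod.ext rfl (Prod.ext rfl (funext fun j => ?_)))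
    by_cases hj : j = i
    · subst hj
      simp
    · by_cases hj1 : j = i + 1
      · subst hj1
        simp
      · simp [hj, hj1, Equiv.swap_apply_of_ne_of_ne]

/-- The letter swap is a word of length `2 * |Q| + 3` in unary gates and state-dependent moves. -/
theorem HeadedTape.exists_word_swapLetters [Fintype Q] [DecidableEq Q] {R : Type}
    (e : Q ≃ Γ × R) (hℓ : 2 ≤ ℓ) :
    ∃ w : List (Equiv.Perm (CConf Q Γ ℓ)), w.length = 2 * Fintype.card Q + 3 ∧
      (∀ x ∈ w, x ∈ TMGens Q Γ ℓ ∨ x⁻¹ ∈ TMGens Q Γ ℓ) ∧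
      w.prod = permHom Q Γ ℓ swapLetters := by
  let s : Equiv.Perm (CConf Q Γ ℓ) := permHom Q Γ ℓ (gate (exchangeRegister e))
  let m : List (Equiv.Perm (CConf Q Γ ℓ)) :=
    Finset.univ.toList.map fun q : Q => permHom Q Γ ℓ (shift (Pi.single q 1))
  have hs : s ∈ TMGens Q Γ ℓ := Or.inl ⟨_, isUnaryGate_gate _⟩
  have hm : ∀ x ∈ m, x ∈ TMGens Q Γ ℓ := by
    intro x hx
    obtain ⟨q, -, rfl⟩ := List.mem_map.mp hx
    exact Or.inr ⟨q, isMoveGate_shift_single q⟩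
  have hprod : m.prod = permHom Q Γ ℓ (shift 1) := by
    rw [← prod_map_shift_single, map_list_prod, List.map_map]
    rfl
  refine ⟨[s] ++ (m.map (·⁻¹)).reverse ++ [s] ++ m ++ [s], ?_, ?_, ?_⟩
  · simp [m]
    ring
  · intro x hx
    simp only [List.mem_append, List.mem_singleton, List.mem_reverse, List.mem_map] at hx
    rcases hx with (((rfl | ⟨y, hy, rfl⟩) | rfl) | hx) | rfl
    · exact Or.inl hs
    · exact Or.inr (by simpa using hm y hy)
    · exact Or.inl hs
    · exact Or.inl (hm x hx)
    · exact Or.inl hs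
  · simp only [List.prod_append, List.prod_singleton, ← List.prod_inv_reverse, hprod,
      swapLetters_eq e hℓ, map_mul, map_inv, s]

theorem HeadedTape.permHom_swapLetters_of_isLeft {w : CConf Q Γ ℓ}
    (hw : ∀ i, (w.1 i).isLeft = true) : permHom Q Γ ℓ swapLetters w = w := by
  obtain ⟨x, rfl⟩ := (equivCConf Q Γ ℓ).surjective w
  rw [permHom_apply]
  rcases x with t | ⟨i, q, t⟩
  · rfl
  · simpa [equivCConf_val, toWord] using hw i

theorem HeadedTape.permHom_swapLetters_of_head {w : CConf Q Γ ℓ} {i : ZMod ℓ} {q : Q} {a : Γ}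
    (hw : w.1 i = Sum.inr (q, a)) :
    (permHom Q Γ ℓ swapLetters w).1 = fun j =>
      if j = i then Sum.inr (q, tapeLetter (w.1 (i + 1)))
      else if j = i + 1 then Sum.inl a
      else w.1 j := by
  obtain ⟨x, rfl⟩ := (equivCConf Q Γ ℓ).surjective w
  rw [permHom_apply]
  simp only [equivCConf_val] at hw ⊢
  rcases x with t | ⟨k, p, t⟩
  · simp [toWord] at hw
  obtain rfl : i = k := by
    by_contra hne
    simp [toWord, hne] at hw
  obtain ⟨rfl, rfl⟩ : p = q ∧ t i = a := by simpa [toWord] using hw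
  rw [tapeLetter_toWord]
  funext j
  by_cases hj : j = i
  · subst hj
    simp [swapLetters, toWord]
  · by_cases hj1 : j = i + 1
    · subst hj1
      simp [swapLetters, toWord, hj]
    · simp [swapLetters, toWord, hj, hj1, Equiv.swap_apply_of_ne_of_ne]

end HeadedTapes

/-! ### The decorated SMART state set -/

instance : Fintype Arrow where
  elems := {.rf, .lf, .rh, .lh}
  complete a := by cases a <;> decide

/-- The ghost of a decorated SMART state contains a letter register. -/
def DQ.letterRegister : DQ ≃ Letter × (SQ × Fin 2 × Fin 2) where
  toFun q := ((finProdFinEquiv (m := 3) (n := 2)).symm q.2.2 |>.1,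
    q.1, q.2.1, (finProdFinEquiv (m := 3) (n := 2)).symm q.2.2 |>.2)
  invFun r := (r.2.1, r.2.2.1, finProdFinEquiv (m := 3) (n := 2) (r.1, r.2.2.2))
  left_inv q := Prod.ext rfl <| Prod.ext rfl <|
    (finProdFinEquiv (m := 3) (n := 2)).apply_symm_apply q.2.2
  right_inv r := by simp only [Equiv.symm_apply_apply]

/-- **Lemma.** There is a constant `K > 0`, independent of `ℓ`, such that for every `ℓ ≥ 2`
the permutation `p` of `C_ℓ` which swaps the two adjacent tape letters at (and to the right
of) the head, keeping the head position and state, belongs to `G_ℓ` with word norm at most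
`K`. -/
theorem swap_adjacent_letters_bounded_norm :
    ∃ K : ℝ, 0 < K ∧ ∀ ℓ : ℕ, 2 ≤ ℓ →
      ∃ π : Equiv.Perm (CConf DQ Letter ℓ),
        π ∈ Subgroup.closure (TMGens DQ Letter ℓ) ∧
        (∀ w : CConf DQ Letter ℓ,
          ((∀ i : ZMod ℓ, (w.1 i).isLeft = true) → π w = w) ∧
          (∀ (i : ZMod ℓ) (q : DQ) (a : Letter), w.1 i = Sum.inr (q, a) →
            (π w).1 = fun j =>
              if j = i then Sum.inr (q, tapeLetter (w.1 (i + 1)))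
              else if j = i + 1 then Sum.inl a
              else w.1 j)) ∧
        (wordNorm (TMGens DQ Letter ℓ) π : ℝ) ≤ K := by
  refine ⟨((2 * Fintype.card DQ + 3 : ℕ) : ℝ), by positivity, fun ℓ hℓ => ?_⟩
  obtain ⟨w, hlen, hgen, hprod⟩ :=
    HeadedTape.exists_word_swapLetters (ℓ := ℓ) DQ.letterRegister hℓ
  refine ⟨HeadedTape.permHom DQ Letter ℓ HeadedTape.swapLetters, ?_,
    fun w => ⟨HeadedTape.permHom_swapLetters_of_isLeft,
      fun _ _ _ => HeadedTape.permHom_swapLetters_of_head⟩, ?_⟩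
  · rw [← hprod]
    refine Subgroup.list_prod_mem _ fun x hx => ?_
    rcases hgen x hx with h | h
    · exact Subgroup.subset_closure h
    · exact (Subgroup.inv_mem_iff _).mp (Subgroup.subset_closure h)
  · exact Nat.cast_le.mpr (Nat.sInf_le ⟨w, hlen, hgen, hprod⟩)
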